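/- Let m ≥ 2 and let M be a perfect matching of CGG(2m) all of whose edges have odd order. If M contains two neighboring edges that cross, then there exists a blocker B of CGG(2m) with B ∩ M = ∅; in particular, M is not a co-blocker. -/

import Mathlib

/-- The vertex set of the complete convex geometric graph `CGG(2m)`:
the vertices are labelled cyclically by `0, 1, …, 2m-1`. -/
abbrev Vtx (m : ℕ) := ZMod (2 * m)

/-- The order of an edge `{i,j}` of `CGG(2m)`: `min (|i-j|, 2m - |i-j|)`. -/
def edgeOrder (m : ℕ) : Sym2 (Vtx m) → ℕ :=
  Sym2.lift ⟨fun i j => min (i - j).val (j - i).val, fun i j => min_comm _ _⟩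

/-- The direction of an edge `{i,j}` of `CGG(2m)`: `i + j (mod 2m)`. -/
def edgeDir (m : ℕ) : Sym2 (Vtx m) → Vtx m :=
  Sym2.lift ⟨fun i j => i + j, fun i j => add_comm i j⟩

/-- `x` lies on the open cyclic arc from `a` to `b`, taken counterclockwise. -/
def InArc (m : ℕ) (a b x : Vtx m) : Prop :=
  0 < (x - a).val ∧ (x - a).val < (b - a).val

/-- Two edges of `CGG(2m)` cross: their endpoints interleave in the cyclic order,
i.e. writing them as `{a,b}` and `{c,d}`, exactly one of `c, d` lies on the open
cyclic arc from `a` to `b` taken counterclockwise. -/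
def Crosses (m : ℕ) (e f : Sym2 (Vtx m)) : Prop :=
  ∃ a b c d : Vtx m, e = s(a, b) ∧ f = s(c, d) ∧
    Xor' (InArc m a b c) (InArc m a b d)

/-- Two edges of `CGG(2m)` are neighbors: some endpoint of one differs by `±1`
(mod `2m`) from some endpoint of the other. -/
def Neighbors (m : ℕ) (e f : Sym2 (Vtx m)) : Prop :=
  ∃ x ∈ e, ∃ y ∈ f, x = y + 1 ∨ y = x + 1

/-- `M` is a perfect matching of `CGG(2m)`: a set of pairwise vertex-disjoint
edges covering all `2m` vertices. -/
def IsPM (m : ℕ) (M : Finset (Sym2 (Vtx m))) : Prop :=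
  (∀ e ∈ M, ¬ e.IsDiag) ∧
  (∀ e ∈ M, ∀ f ∈ M, e ≠ f → ∀ x : Vtx m, x ∈ e → x ∉ f) ∧
  (∀ x : Vtx m, ∃ e ∈ M, x ∈ e)

/-- `M` is a simple perfect matching (SPM) of `CGG(2m)`: a perfect matching
no two of whose edges cross. -/
def IsSPM (m : ℕ) (M : Finset (Sym2 (Vtx m))) : Prop :=
  IsPM m M ∧ ∀ e ∈ M, ∀ f ∈ M, e ≠ f → ¬ Crosses m e f

/-- `M` is a semi-simple perfect matching of `CGG(2m)`: a perfect matching all of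
whose edges have odd order, and no two neighboring edges of which cross. -/
def IsSemiSimple (m : ℕ) (M : Finset (Sym2 (Vtx m))) : Prop :=
  IsPM m M ∧ (∀ e ∈ M, Odd (edgeOrder m e)) ∧
  ∀ e ∈ M, ∀ f ∈ M, e ≠ f → Neighbors m e f → ¬ Crosses m e f

/-- `B` is a set of edges of `CGG(2m)` that meets every member of the family `F`,
of minimum cardinality among all sets of edges meeting every member of `F`. -/
def MinTransversal (m : ℕ) (F : Set (Finset (Sym2 (Vtx m))))
    (B : Finset (Sym2 (Vtx m))) : Prop :=
  (∀ e ∈ B, ¬ e.IsDiag) ∧ (∀ M ∈ F, (B ∩ M).Nonempty) ∧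
  ∀ B' : Finset (Sym2 (Vtx m)), (∀ e ∈ B', ¬ e.IsDiag) →
    (∀ M ∈ F, (B' ∩ M).Nonempty) → B.card ≤ B'.card

/-- `B` is a blocker of `CGG(2m)`: a set of edges meeting every SPM, of minimum
cardinality among all sets of edges meeting every SPM. -/
def IsBlocker (m : ℕ) (B : Finset (Sym2 (Vtx m))) : Prop :=
  MinTransversal m {M | IsSPM m M} B

/-- `C` is a co-blocker of `CGG(2m)`: a set of edges meeting every blocker, of
minimum cardinality among all sets of edges meeting every blocker. -/
def IsCoBlocker (m : ℕ) (C : Finset (Sym2 (Vtx m))) : Prop :=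
  MinTransversal m {B | IsBlocker m B} C

/-- Cyclic distances can be computed from the distances to a common origin `a`. -/
theorem val_sub_eq_ite {n : ℕ} [NeZero n] (a x y : ZMod n) :
    (x - y).val = if (y - a).val ≤ (x - a).val then (x - a).val - (y - a).val
      else n + (x - a).val - (y - a).val := by
  have hxy : x - y = (x - a) - (y - a) := by ring
  rw [hxy]
  generalize x - a = u
  generalize y - a = w
  split_ifs with h
  · exact ZMod.val_sub h
  · have hwu : (w - u).val = w.val - u.val := ZMod.val_sub (by omega)
    have hne : w - u ≠ 0 := fun h0 => h (by rw [sub_eq_zero.mp h0])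
    rw [← neg_sub, ZMod.neg_val, if_neg hne, hwu]
    have := ZMod.val_lt w
    omega

theorem val_sub_eq_val_sub_iff {n : ℕ} [NeZero n] (a x y : ZMod n) :
    (x - a).val = (y - a).val ↔ x = y := by
  rw [(ZMod.val_injective n).eq_iff, sub_left_inj]

theorem val_add_natCast_sub {n k : ℕ} (a : ZMod n) (hk : k < n) :
    (a + (k : ZMod n) - a).val = k := by
  rw [add_sub_cancel_left, ZMod.val_natCast_of_lt hk]

theorem add_natCast_val_sub {n : ℕ} [NeZero n] (a x : ZMod n) :
    a + ((x - a).val : ZMod n) = x := by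
  rw [ZMod.natCast_zmod_val, add_sub_cancel]

theorem IsPM.exists_mate {m : ℕ} {M : Finset (Sym2 (Vtx m))} (h : IsPM m M) (x : Vtx m) :
    ∃ y, s(x, y) ∈ M := by
  obtain ⟨e, he, hx⟩ := h.2.2 x
  obtain ⟨y, rfl⟩ := hx
  exact ⟨y, he⟩

theorem IsPM.ne {m : ℕ} {M : Finset (Sym2 (Vtx m))} (h : IsPM m M) {x y : Vtx m}
    (hxy : s(x, y) ∈ M) : x ≠ y :=
  fun hd => h.1 _ hxy (Sym2.mk_isDiag_iff.mpr hd)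

theorem IsPM.mate_unique {m : ℕ} {M : Finset (Sym2 (Vtx m))} (h : IsPM m M) {x y z : Vtx m}
    (hy : s(x, y) ∈ M) (hz : s(x, z) ∈ M) : y = z := by
  by_contra hne
  exact h.2.1 _ hy _ hz (fun he => hne (Sym2.congr_right.mp he)) x
    (Sym2.mem_mk_left x y) (Sym2.mem_mk_left x z)

/-- Crossing is symmetric on vertex-disjoint edges. -/
theorem Crosses.symm {m : ℕ} [NeZero (2 * m)] {e f : Sym2 (Vtx m)} (h : Crosses m e f)
    (hdisj : ∀ x ∈ e, x ∉ f) : Crosses m f e := by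
  obtain ⟨a, b, c, d, rfl, rfl, hx⟩ := h
  refine ⟨c, d, a, b, rfl, rfl, ?_⟩
  replace hdisj := Sym2.ball.mp hdisj
  simp only [Sym2.mem_iff, not_or,
    ← val_sub_eq_val_sub_iff a, sub_self, ZMod.val_zero] at hdisj
  simp only [InArc, Xor', Xor, val_sub_eq_ite a _ c, sub_self, ZMod.val_zero] at hx ⊢
  have := ZMod.val_lt (b - a)
  have := ZMod.val_lt (c - a)
  have := ZMod.val_lt (d - a)
  split_ifs <;> omega

/-- If `{a, b}` and `{a + 1, d}` are disjoint and cross, then `d` lies beyond `b`. -/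
theorem Crosses.val_sub_lt {m : ℕ} [NeZero (2 * m)] (hm : 2 ≤ m) {a b d : Vtx m}
    (h : Crosses m s(a, b) s(a + 1, d)) (hdisj : ∀ x ∈ s(a, b), x ∉ s(a + 1, d)) :
    (b - a).val < (d - a).val := by
  obtain ⟨p, q, r, t, hpq, hrt, hx⟩ := h
  have h1 : (a + 1 - a).val = 1 := by
    simpa using val_add_natCast_sub a (k := 1) (by omega : 1 < 2 * m)
  replace hdisj := Sym2.ball.mp hdisj
  simp only [Sym2.mem_iff, not_or,
    ← val_sub_eq_val_sub_iff a, sub_self, ZMod.val_zero, h1] at hdisj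
  simp only [InArc, Xor', Xor, val_sub_eq_ite a _ p] at hx
  have := ZMod.val_lt (b - a)
  have := ZMod.val_lt (d - a)
  rw [Sym2.eq_iff] at hpq hrt
  rcases hpq with ⟨rfl, rfl⟩ | ⟨rfl, rfl⟩ <;> rcases hrt with ⟨rfl, rfl⟩ | ⟨rfl, rfl⟩ <;>
    simp only [sub_self, ZMod.val_zero, h1] at hx <;> split_ifs at hx <;> omega

/-- The edges of a simple perfect matching have odd order. -/
theorem IsSPM.odd_val_sub {m : ℕ} [NeZero (2 * m)] {S : Finset (Sym2 (Vtx m))}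
    (h : IsSPM m S) {a x : Vtx m} (hax : s(a, x) ∈ S) : Odd (x - a).val := by
  choose g hg using h.1.exists_mate
  have hgg : ∀ y, g (g y) = y := fun y =>
    h.1.mate_unique (hg (g y)) (Sym2.eq_swap ▸ hg y)
  set A : Finset (Vtx m) := {y | 0 < (y - a).val ∧ (y - a).val < (x - a).val} with hA
  have hmaps : ∀ y ∈ A, g y ∈ A := by
    intro y hy
    simp only [hA, Finset.mem_filter, Finset.mem_univ, true_and] at hy ⊢
    by_contra hgy
    have hne : s(a, x) ≠ s(y, g y) := by
      intro he
      rcases Sym2.eq_iff.mp he with ⟨rfl, -⟩ | ⟨-, rfl⟩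
      · simp at hy
      · simp at hy
    exact h.2 _ hax _ (hg y) hne ⟨a, x, y, g y, rfl, rfl, Or.inl ⟨hy, hgy⟩⟩
  have hsum : ∑ _y ∈ A, (1 : ZMod 2) = 0 :=
    Finset.sum_involution (fun y _ => g y) (fun _ _ => by decide)
      (fun y _ _ => (h.1.ne (hg y)).symm) hmaps (fun y _ => hgg y)
  have heven : Even A.card := by
    rw [← ZMod.natCast_eq_zero_iff_even]
    simpa using hsum
  have hcard : A.card = (x - a).val - 1 := by
    have himg : A.image (fun y => (y - a).val) = Finset.Ioo 0 (x - a).val := by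
      ext k
      simp only [hA, Finset.mem_image, Finset.mem_filter, Finset.mem_univ, true_and,
        Finset.mem_Ioo]
      constructor
      · rintro ⟨y, hy, rfl⟩
        exact hy
      · intro hk
        have hv := val_add_natCast_sub a (hk.2.trans (ZMod.val_lt _))
        exact ⟨a + k, by rwa [hv], hv⟩
    rw [← Finset.card_image_of_injective A
      (fun y z hyz => (val_sub_eq_val_sub_iff a y z).mp hyz), himg, Nat.card_Ioo]
    omega
  have hpos : (x - a).val ≠ 0 := by
    rw [Ne, ZMod.val_eq_zero, sub_eq_zero]
    exact (h.1.ne hax).symm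
  rw [hcard] at heven
  obtain ⟨r, hr⟩ := heven
  exact ⟨r, by omega⟩

/-- The set of all edges of direction `k` (including loops when `k` is even). -/
def parallelClass (m : ℕ) [NeZero (2 * m)] (k : Vtx m) : Finset (Sym2 (Vtx m)) :=
  Finset.univ.image fun x => s(x, k - x)

theorem edgeDir_eq_of_mem_parallelClass {m : ℕ} [NeZero (2 * m)] {k : Vtx m}
    {e : Sym2 (Vtx m)} (he : e ∈ parallelClass m k) : edgeDir m e = k := by
  obtain ⟨x, -, rfl⟩ := Finset.mem_image.mp he
  exact add_sub_cancel x k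

theorem eq_mk_of_mem_parallelClass {m : ℕ} [NeZero (2 * m)] {k x : Vtx m}
    {e : Sym2 (Vtx m)} (he : e ∈ parallelClass m k) (hx : x ∈ e) : e = s(x, k - x) := by
  have hdir := edgeDir_eq_of_mem_parallelClass he
  obtain ⟨y, rfl⟩ := hx
  rw [← hdir]
  simp [edgeDir]

theorem two_mul_ne_odd {m : ℕ} (x : Vtx m) (i : ℕ) : x + x ≠ (2 * i + 1 : ℕ) := by
  intro h
  have h2 := congrArg (ZMod.castHom (dvd_mul_right 2 m) (ZMod 2)) h
  rw [map_add, CharTwo.add_self_eq_zero, map_natCast, eq_comm,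
    ZMod.natCast_eq_zero_iff_even] at h2
  exact Nat.not_even_two_mul_add_one i h2

theorem isSPM_parallelClass {m : ℕ} [NeZero (2 * m)] (i : ℕ) :
    IsSPM m (parallelClass m (2 * i + 1 : ℕ)) := by
  refine ⟨⟨?_, ?_, ?_⟩, ?_⟩
  · intro e he hd
    obtain ⟨x, -, rfl⟩ := Finset.mem_image.mp he
    exact two_mul_ne_odd x i (eq_sub_iff_add_eq.mp (Sym2.mk_isDiag_iff.mp hd))
  · intro e he f hf hne x hxe hxf
    exact hne ((eq_mk_of_mem_parallelClass he hxe).trans (eq_mk_of_mem_parallelClass hf hxf).symm)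
  · exact fun x => ⟨_, Finset.mem_image_of_mem _ (Finset.mem_univ x), Sym2.mem_mk_left _ _⟩
  · rintro _ he _ hf - ⟨a, b, c, d, rfl, rfl, hx⟩
    have hab : a + b = _ := edgeDir_eq_of_mem_parallelClass he
    have hcd : c + d = _ := edgeDir_eq_of_mem_parallelClass hf
    have hd : d - a = b - c := by
      linear_combination hcd - hab
    simp only [InArc, Xor', Xor, hd, val_sub_eq_ite a b c] at hx
    have := ZMod.val_lt (b - a)
    have := ZMod.val_lt (c - a)
    split_ifs at hx <;> omega

/-- Any set of edges meeting every simple perfect matching has at least `m` elements. -/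
theorem le_card_of_meets_isSPM {m : ℕ} [NeZero (2 * m)] {B : Finset (Sym2 (Vtx m))}
    (hB : ∀ S, IsSPM m S → (B ∩ S).Nonempty) : m ≤ B.card := by
  have hsub : (Finset.range m).image (fun i : ℕ => ((2 * i + 1 : ℕ) : Vtx m)) ⊆
      B.image (edgeDir m) := by
    intro k hk
    obtain ⟨i, -, rfl⟩ := Finset.mem_image.mp hk
    obtain ⟨e, he⟩ := hB _ (isSPM_parallelClass i)
    rw [Finset.mem_inter] at he
    exact Finset.mem_image.mpr ⟨e, he.1, edgeDir_eq_of_mem_parallelClass he.2⟩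
  have hinj : Set.InjOn (fun i : ℕ => ((2 * i + 1 : ℕ) : Vtx m)) (Finset.range m) := by
    intro i hi j hj hij
    rw [Finset.coe_range, Set.mem_Iio] at hi hj
    have hv := congrArg ZMod.val hij
    simp only [ZMod.val_natCast_of_lt (by omega : 2 * i + 1 < 2 * m),
      ZMod.val_natCast_of_lt (by omega : 2 * j + 1 < 2 * m)] at hv
    omega
  calc m = ((Finset.range m).image (fun i : ℕ => ((2 * i + 1 : ℕ) : Vtx m))).card := by
        rw [Finset.card_image_of_injOn hinj, Finset.card_range]
    _ ≤ (B.image (edgeDir m)).card := Finset.card_le_card hsub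
    _ ≤ B.card := Finset.card_image_le

/-- The double broom with spine `{a, a + 1}`: `a + 1` is joined to `a + 2i` for `i ≤ j`, and
`a` is joined to `a + 2i + 1` for `j < i < m`. -/
def doubleBroom (m : ℕ) (a : Vtx m) (j : ℕ) : Finset (Sym2 (Vtx m)) :=
  (Finset.range m).image fun i =>
    if i ≤ j then s(a + 1, a + (2 * i : ℕ)) else s(a, a + (2 * i + 1 : ℕ))

theorem mem_doubleBroom {m : ℕ} {a : Vtx m} {j : ℕ} {e : Sym2 (Vtx m)} :
    e ∈ doubleBroom m a j ↔ ∃ i < m, (i ≤ j ∧ e = s(a + 1, a + (2 * i : ℕ))) ∨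
      (j < i ∧ e = s(a, a + (2 * i + 1 : ℕ))) := by
  simp only [doubleBroom, Finset.mem_image, Finset.mem_range]
  refine exists_congr fun i => and_congr_right fun _ => ?_
  split_ifs with h
  · simp [h, not_lt.mpr h, eq_comm]
  · simp [h, not_le.mp h, eq_comm]

theorem doubleBroom_inter_nonempty {m : ℕ} [NeZero (2 * m)] (hm : 2 ≤ m) (a : Vtx m) (j : ℕ)
    {S : Finset (Sym2 (Vtx m))} (hS : IsSPM m S) : (doubleBroom m a j ∩ S).Nonempty := by
  have h1 : (a + 1 - a).val = 1 := by
    simpa using val_add_natCast_sub a (k := 1) (by omega : 1 < 2 * m)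
  obtain ⟨x, hx⟩ := hS.1.exists_mate a
  obtain ⟨i, hi⟩ := hS.odd_val_sub hx
  have hxlt := ZMod.val_lt (x - a)
  have hxi : a + (2 * i + 1 : ℕ) = x := hi ▸ add_natCast_val_sub a x
  by_cases hij : j < i
  · exact ⟨_, Finset.mem_inter.mpr
      ⟨mem_doubleBroom.mpr ⟨i, by omega, Or.inr ⟨hij, by rw [hxi]⟩⟩, hx⟩⟩
  obtain ⟨y, hy⟩ := hS.1.exists_mate (a + 1)
  obtain ⟨l, hl⟩ := hS.odd_val_sub hy
  have hylt := ZMod.val_lt (y - a)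
  rw [val_sub_eq_ite a, h1] at hl
  have hle : (y - a).val ≤ (x - a).val := by
    by_cases heq : s(a, x) = s(a + 1, y)
    · rcases Sym2.eq_iff.mp heq with ⟨h, -⟩ | ⟨rfl, -⟩
      · rw [← h, sub_self, ZMod.val_zero] at h1
        omega
      · simp
    by_contra hlt
    have hxa : x ≠ a + 1 := by
      rintro rfl
      exact hS.1.2.1 _ hx _ hy heq _ (Sym2.mem_mk_right _ _) (Sym2.mem_mk_left _ _)
    rw [Ne, ← val_sub_eq_val_sub_iff a, h1] at hxa
    refine hS.2 _ hx _ hy heq ⟨a, x, a + 1, y, rfl, rfl, Or.inl ⟨?_, ?_⟩⟩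
    · simp only [InArc, h1]
      omega
    · simp only [InArc]
      omega
  obtain ⟨r, hr⟩ : ∃ r, (y - a).val = 2 * r := by
    split_ifs at hl
    · exact ⟨l + 1, by omega⟩
    · exact ⟨0, by omega⟩
  refine ⟨_, Finset.mem_inter.mpr
    ⟨mem_doubleBroom.mpr ⟨r, by omega, Or.inl ⟨by omega, ?_⟩⟩, hy⟩⟩
  rw [← hr, add_natCast_val_sub]

theorem isBlocker_doubleBroom {m : ℕ} [NeZero (2 * m)] (hm : 2 ≤ m) (a : Vtx m) (j : ℕ) :
    IsBlocker m (doubleBroom m a j) := by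
  have h1 : (a + 1 - a).val = 1 := by
    simpa using val_add_natCast_sub a (k := 1) (by omega : 1 < 2 * m)
  refine ⟨?_, fun S hS => doubleBroom_inter_nonempty hm a j hS, fun B' _ hB' => ?_⟩
  · intro e he
    obtain ⟨i, hi, ⟨-, rfl⟩ | ⟨-, rfl⟩⟩ := mem_doubleBroom.mp he
    · rw [Sym2.mk_isDiag_iff, ← val_sub_eq_val_sub_iff a, h1,
        val_add_natCast_sub a (by omega)]
      omega
    · rw [Sym2.mk_isDiag_iff, ← val_sub_eq_val_sub_iff a, sub_self, ZMod.val_zero,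
        val_add_natCast_sub a (by omega)]
      omega
  · calc (doubleBroom m a j).card ≤ (Finset.range m).card := Finset.card_image_le
      _ = m := Finset.card_range m
      _ ≤ B'.card := le_card_of_meets_isSPM hB'

/-- A perfect matching with crossing edges through `a` and `a + 1` avoids some blocker. -/
theorem IsPM.exists_disjoint_blocker {m : ℕ} [NeZero (2 * m)] (hm : 2 ≤ m)
    {M : Finset (Sym2 (Vtx m))} (hM : IsPM m M) {e f : Sym2 (Vtx m)} (he : e ∈ M) (hf : f ∈ M)
    (hef : e ≠ f) (hcr : Crosses m e f) {a : Vtx m} (hae : a ∈ e) (haf : a + 1 ∈ f) :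
    ∃ B : Finset (Sym2 (Vtx m)), IsBlocker m B ∧ ∀ x ∈ B, x ∉ M := by
  obtain ⟨b, rfl⟩ := hae
  obtain ⟨d, rfl⟩ := haf
  have hlt := hcr.val_sub_lt hm (hM.2.1 _ he _ hf hef)
  refine ⟨doubleBroom m a ((b - a).val / 2), isBlocker_doubleBroom hm a _, ?_⟩
  intro x hx hxM
  obtain ⟨i, hi, ⟨hij, rfl⟩ | ⟨hij, rfl⟩⟩ := mem_doubleBroom.mp hx
  · rw [← hM.mate_unique hxM hf, val_add_natCast_sub a (by omega)] at hlt
    omega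
  · rw [← hM.mate_unique hxM he, val_add_natCast_sub a (by omega)] at hij
    omega

/-- Let `m ≥ 2` and let `M` be a perfect matching of `CGG(2m)` all of whose
edges have odd order. If `M` contains two neighboring edges that cross, then
some blocker of `CGG(2m)` is disjoint from `M`; in particular `M` is not a
co-blocker. -/
theorem crossing_neighbors_not_coBlocker (m : ℕ) (hm : 2 ≤ m)
    (M : Finset (Sym2 (Vtx m))) (hPM : IsPM m M)
    (hodd : ∀ e ∈ M, Odd (edgeOrder m e))
    (e f : Sym2 (Vtx m)) (he : e ∈ M) (hf : f ∈ M) (hef : e ≠ f)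
    (hnb : Neighbors m e f) (hcr : Crosses m e f) :
    (∃ B : Finset (Sym2 (Vtx m)), IsBlocker m B ∧ ∀ x ∈ B, x ∉ M) ∧
    ¬ IsCoBlocker m M := by
  have : NeZero (2 * m) := ⟨by omega⟩
  have key : ∃ B : Finset (Sym2 (Vtx m)), IsBlocker m B ∧ ∀ x ∈ B, x ∉ M := by
    obtain ⟨x, hx, y, hy, rfl | rfl⟩ := hnb
    · exact hPM.exists_disjoint_blocker hm hf he hef.symm
        (hcr.symm (hPM.2.1 _ he _ hf hef)) hy hx
    · exact hPM.exists_disjoint_blocker hm he hf hef hcr hx hy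
  refine ⟨key, fun hco => ?_⟩
  obtain ⟨B, hB, hdisj⟩ := key
  obtain ⟨x, hx⟩ := hco.2.1 B hB
  rw [Finset.mem_inter] at hx
  exact hdisj x hx.2 hx.1
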